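/- (Theorem 3.1, characteristic-function form.) Let N ≥ 1 be an integer, let a : ℝ → ℝ be measurable, nonnegative, vanishing outside (0,2), and Lebesgue integrable, and fix t > 0. Let (h_n) be a sequence of positive reals with h_n → 0, set τ_n = t/n, and assume for every n the normalization condition 2τ_n ∫₀² a(α) b(α) R(α) h_n^{−α} dα ≤ 1. Define transition probabilities p₀^{(n)} = 1 − 2τ_n Σ_{m≠0} Q_m(h_n)/|m|^N and p_k^{(n)} = 2τ_n Q_k(h_n)/|k|^N for k ≠ 0. Then for every ξ ∈ ℝ^N, the characteristic function of the n-step random walk converges: ( Σ_{k∈ℤ^N} p_k^{(n)} e^{i(h_n k)·ξ} )^n → exp( −t ∫₀² a(α)|ξ|^α dα ) as n → ∞. That is, the scaling limit of the random walk is the process whose characteristic function is the Fourier transform of the fundamental solution of the distributed fractional order diffusion equation ∂u/∂t = ∫₀² a(α) D₀^α u dα. -/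

import Mathlib

open MeasureTheory Filter
open scoped Topology ENNReal

/-- The normalizing constant `b(α)` of the hypersingular integral representation of the
fractional Laplacian `D₀^α = -(-Δ)^{α/2}` in dimension `N`. -/
noncomputable def bConst (N : ℕ) (α : ℝ) : ℝ :=
  α * Real.Gamma (α / 2) * Real.Gamma (((N : ℝ) + α) / 2) * Real.sin (α * Real.pi / 2) /
    (2 ^ ((2 : ℝ) - α) * Real.pi ^ (1 + (N : ℝ) / 2))

/-- Euclidean norm of a lattice point `k ∈ ℤ^N`. -/
noncomputable def latNorm (N : ℕ) (k : Fin N → ℤ) : ℝ :=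
  Real.sqrt (∑ i, ((k i : ℝ)) ^ 2)

/-- Euclidean inner product `k·ξ` of a lattice point `k ∈ ℤ^N` with `ξ ∈ ℝ^N`. -/
noncomputable def latDot (N : ℕ) (k : Fin N → ℤ) (ξ : EuclideanSpace ℝ (Fin N)) : ℝ :=
  ∑ i, (k i : ℝ) * ξ i

/-- The lattice sum `R(α) = ∑_{k ∈ ℤ^N, k ≠ 0} |k|^{-(N+α)}`. -/
noncomputable def Rlat (N : ℕ) (α : ℝ) : ℝ :=
  ∑' k : {k : Fin N → ℤ // k ≠ 0}, latNorm N k.1 ^ (-((N : ℝ) + α))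

/-- `Q_m(h) = ∫₀² |m|^{-α} a(α) b(α) h^{-α} dα`. -/
noncomputable def Qcoef (N : ℕ) (a : ℝ → ℝ) (h : ℝ) (m : Fin N → ℤ) : ℝ :=
  ∫ α in (0 : ℝ)..2, latNorm N m ^ (-α) * a α * bConst N α * h ^ (-α)

/-- The normalization constant `σ(τ,h) = 2τ ∑_{m≠0} Q_m(h)/|m|^N`. -/
noncomputable def sigmaConst (N : ℕ) (a : ℝ → ℝ) (τ h : ℝ) : ℝ :=
  2 * τ * ∑' m : {m : Fin N → ℤ // m ≠ 0}, Qcoef N a h m.1 / latNorm N m.1 ^ (N : ℝ)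

/-- The transition probabilities: `p₀ = 1 - σ(τ,h)`, `p_k = 2τ Q_k(h)/|k|^N` for `k ≠ 0`. -/
noncomputable def transProb (N : ℕ) (a : ℝ → ℝ) (τ h : ℝ) (k : Fin N → ℤ) : ℝ :=
  if k = 0 then 1 - sigmaConst N a τ h else 2 * τ * Qcoef N a h k / latNorm N k ^ (N : ℝ)


lemma prod_tsum_aux (N : ℕ) (f : Fin N → ℤ → ℂ) (hf : ∀ i, Summable fun m => ‖f i m‖) :
    (Summable fun k : Fin N → ℤ => ‖∏ i, f i (k i)‖) ∧
      ∑' k : Fin N → ℤ, ∏ i, f i (k i) = ∏ i, ∑' m, f i m := by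
  induction N with
  | zero =>
    constructor
    · exact Summable.of_finite
    · simp
  | succ N ih =>
    obtain ⟨h1, h2⟩ := ih (fun i => f i.succ) (fun i => hf _)
    have e1 : ∀ p : ℤ × (Fin N → ℤ), ∏ i, f i ((Fin.consEquiv (fun _ => ℤ)) p i)
        = f 0 p.1 * ∏ i : Fin N, f i.succ (p.2 i) := by
      intro p
      rw [Fin.prod_univ_succ]
      simp [Fin.consEquiv]
    constructor
    · rw [← (Fin.consEquiv (fun _ => ℤ)).summable_iff]
      refine ((hf 0).mul_norm h1).congr ?_
      intro p
      simp only [Function.comp]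
      rw [e1]
    · rw [← (Fin.consEquiv (fun _ => ℤ)).tsum_eq, Fin.prod_univ_succ, ← h2,
        tsum_mul_tsum_of_summable_norm (hf 0) h1]
      exact tsum_congr e1

lemma summable_gauss1 {s : ℝ} (hs : 0 < s) :
    Summable fun m : ℤ => Real.exp (-s * (m : ℝ) ^ 2) := by
  have h := summable_pow_mul_jacobiTheta₂_term_bound 0 (T := s / Real.pi) (by positivity) 0
  refine h.congr fun m => ?_
  have := Real.pi_ne_zero
  rw [pow_zero, one_mul]
  congr 1
  field_simp
  ring

lemma norm_gauss1 (s x : ℝ) (m : ℤ) :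
    ‖Complex.exp (((-s * (m : ℝ) ^ 2 : ℝ) : ℂ) + Complex.I * ((x * m : ℝ) : ℂ))‖
      = Real.exp (-s * (m : ℝ) ^ 2) := by
  rw [Complex.norm_exp, Complex.add_re, Complex.ofReal_re, Complex.re_mul_ofReal, Complex.I_re]
  simp

lemma poisson1 {s : ℝ} (hs : 0 < s) (x : ℝ) :
    ∑' m : ℤ, Complex.exp (((-s * (m : ℝ) ^ 2 : ℝ) : ℂ) + Complex.I * ((x * m : ℝ) : ℂ))
      = ((Real.sqrt (Real.pi / s) *
          ∑' n : ℤ, Real.exp (-((2 * Real.pi * n - x) ^ 2 / (4 * s))) : ℝ) : ℂ) := by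
  have hp : (Real.pi : ℂ) ≠ 0 := by exact_mod_cast Real.pi_ne_zero
  have hsc : (s : ℂ) ≠ 0 := by exact_mod_cast hs.ne'
  have h := Complex.tsum_exp_neg_quadratic (a := ((s / Real.pi : ℝ) : ℂ))
    (by rw [Complex.ofReal_re]; positivity) (Complex.I * ((x / (2 * Real.pi) : ℝ) : ℂ))
  have e1 : ∀ m : ℤ, (-Real.pi * ((s / Real.pi : ℝ) : ℂ) * m ^ 2 +
      2 * Real.pi * (Complex.I * ((x / (2 * Real.pi) : ℝ) : ℂ)) * m : ℂ)
      = ((-s * (m : ℝ) ^ 2 : ℝ) : ℂ) + Complex.I * ((x * m : ℝ) : ℂ) := by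
    intro m; push_cast; field_simp
  have e2 : ∀ n : ℤ, (-Real.pi / ((s / Real.pi : ℝ) : ℂ) *
      (n + Complex.I * (Complex.I * ((x / (2 * Real.pi) : ℝ) : ℂ))) ^ 2 : ℂ)
      = ((-((2 * Real.pi * n - x) ^ 2 / (4 * s)) : ℝ) : ℂ) := by
    intro m
    rw [← mul_assoc Complex.I, Complex.I_mul_I]
    push_cast; field_simp; ring
  simp_rw [e1, e2] at h
  rw [h]
  rw [Complex.ofReal_mul, Complex.ofReal_tsum]
  simp_rw [Complex.ofReal_exp]
  congr 1
  rw [show (1 / 2 : ℂ) = ((1 / 2 : ℝ) : ℂ) by push_cast; rfl,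
    ← Complex.ofReal_cpow (by positivity), ← Real.sqrt_eq_rpow, ← Complex.ofReal_one,
    ← Complex.ofReal_div]
  congr 1
  rw [one_div, ← Real.sqrt_inv, inv_div]

lemma poisson1_tendsto {u : ℝ} (hu : 0 < u) (x : ℝ) :
    Tendsto (fun h : ℝ => (h : ℂ) * ∑' m : ℤ,
      Complex.exp (((-(u * h ^ 2) * (m : ℝ) ^ 2 : ℝ) : ℂ) + Complex.I * ((h * x * m : ℝ) : ℂ)))
      (𝓝[>] 0) (𝓝 ((Real.sqrt (Real.pi / u) * Real.exp (-(x ^ 2 / (4 * u))) : ℝ) : ℂ)) := by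
  have key : Tendsto (fun h : ℝ => ∑' n : ℤ, Real.exp (-((2 * Real.pi * n / h - x) ^ 2 / (4 * u))))
      (𝓝[>] 0) (𝓝 (∑' n : ℤ, if n = 0 then Real.exp (-(x ^ 2 / (4 * u))) else 0)) := by
    refine tendsto_tsum_of_dominated_convergence
      (bound := fun n : ℤ => Real.exp (-(1 / (4 * u)) * (n : ℝ) ^ 2))
      (summable_gauss1 (by positivity)) ?_ ?_
    · intro n
      by_cases hn : n = 0
      · subst hn
        simp only [if_true]
        refine tendsto_const_nhds.congr fun h => ?_
        simp
      · simp only [hn, if_false]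
        refine Real.tendsto_exp_neg_atTop_nhds_zero.comp ?_
        refine Tendsto.atTop_div_const (by positivity) ?_
        have hinv : Tendsto (fun h : ℝ => h⁻¹) (𝓝[>] 0) atTop := tendsto_inv_nhdsGT_zero
        have h2 : Tendsto (fun h : ℝ => (2 * Real.pi * |(n : ℝ)|) * h⁻¹ - |x|) (𝓝[>] 0) atTop :=
          tendsto_atTop_add_const_right _ _ (hinv.const_mul_atTop (by positivity))
        have h3 : Tendsto (fun h : ℝ => ((2 * Real.pi * |(n : ℝ)|) * h⁻¹ - |x|) ^ 2)
          (𝓝[>] 0) atTop := (tendsto_pow_atTop (by norm_num)).comp h2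
        refine tendsto_atTop_mono' _ ?_ h3
        filter_upwards [self_mem_nhdsWithin, h2.eventually_ge_atTop 0] with h hh hh2
        rw [← sq_abs (2 * Real.pi * n / h - x)]
        have : |2 * Real.pi * n / h| = 2 * Real.pi * |(n : ℝ)| * h⁻¹ := by
          rw [abs_div, abs_mul, abs_of_pos (show (0:ℝ) < h from hh),
            abs_of_pos (show 0 < 2 * Real.pi by positivity)]
          rfl
        gcongr
        rw [← this]
        exact abs_sub_abs_le_abs_sub _ _
    · have h1 : ∀ᶠ h : ℝ in 𝓝[>] 0, h * (|x| + 1) < 1 := by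
        have : Tendsto (fun h : ℝ => h * (|x| + 1)) (𝓝[>] 0) (𝓝 0) := by
          have := (tendsto_id (α := ℝ) (x := 𝓝 0)).mul_const (|x| + 1)
          simp only [id, zero_mul] at this
          exact this.mono_left nhdsWithin_le_nhds
        exact this.eventually_lt_const (by norm_num)
      filter_upwards [self_mem_nhdsWithin, h1] with h hh hh1 n
      have hh : 0 < h := hh
      rw [Real.norm_eq_abs, abs_of_pos (Real.exp_pos _), Real.exp_le_exp, neg_mul, neg_le_neg_iff,
        one_div_mul_eq_div]
      gcongr ?_ / _
      by_cases hn : n = 0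
      · subst hn; simp; positivity
      have hn1 : (1 : ℝ) ≤ |(n : ℝ)| := by exact_mod_cast Int.one_le_abs hn
      rw [sq_le_sq]
      have : |2 * Real.pi * n / h| = 2 * Real.pi * |(n : ℝ)| / h := by
        rw [abs_div, abs_mul, abs_of_pos hh,
            abs_of_pos (show 0 < 2 * Real.pi by positivity)]
      refine le_trans ?_ (abs_sub_abs_le_abs_sub _ _)
      rw [this, le_sub_iff_add_le, le_div_iff₀ hh]
      have hp := Real.pi_gt_three
      have hx := abs_nonneg x
      have : h * |(n : ℝ)| ≤ |(n : ℝ)| := by nlinarith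
      nlinarith
  rw [tsum_ite_eq] at key
  have := (Complex.continuous_ofReal.tendsto _).comp (key.const_mul (Real.sqrt (Real.pi / u)))
  refine this.congr' ?_
  filter_upwards [self_mem_nhdsWithin] with h hh
  have hh : 0 < h := hh
  rw [poisson1 (by positivity)]
  simp only [Function.comp]
  rw [← Complex.ofReal_mul]
  congr 1
  rw [← mul_assoc]
  congr 1
  · rw [← div_div, Real.sqrt_div (x := Real.pi / u) (by positivity), Real.sqrt_sq hh.le]
    field_simp
  · refine tsum_congr fun n => ?_
    congr 2
    field_simp

lemma summable_gaussN (N : ℕ) {s : ℝ} (hs : 0 < s) :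
    Summable fun k : Fin N → ℤ => Real.exp (-s * ∑ i, (k i : ℝ) ^ 2) := by
  have := (prod_tsum_aux N (fun _ m => (Real.exp (-s * (m : ℝ) ^ 2) : ℂ)) (fun i => by
    refine (summable_gauss1 hs).congr fun m => ?_
    rw [Complex.norm_real, Real.norm_eq_abs, abs_of_pos (Real.exp_pos _)])).1
  refine this.congr fun k => ?_
  rw [← Complex.ofReal_prod, Complex.norm_real, Real.norm_eq_abs, ← Real.exp_sum,
    abs_of_pos (Real.exp_pos _), Finset.mul_sum]

lemma gaussN_prod (N : ℕ) {s : ℝ} (hs : 0 < s) (h : ℝ) (ξ : EuclideanSpace ℝ (Fin N)) :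
    ∑' k : Fin N → ℤ, Complex.exp (((-s * ∑ i, (k i : ℝ) ^ 2 : ℝ) : ℂ) +
      Complex.I * ((h * latDot N k ξ : ℝ) : ℂ))
    = ∏ i, ∑' m : ℤ, Complex.exp (((-s * (m : ℝ) ^ 2 : ℝ) : ℂ) +
        Complex.I * ((h * ξ i * m : ℝ) : ℂ)) := by
  rw [← (prod_tsum_aux N (fun i m => Complex.exp (((-s * (m : ℝ) ^ 2 : ℝ) : ℂ) +
        Complex.I * ((h * ξ i * m : ℝ) : ℂ))) (fun i => by
      simp_rw [norm_gauss1]; exact summable_gauss1 hs)).2]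
  refine tsum_congr fun k => ?_
  rw [← Complex.exp_sum, Finset.sum_add_distrib, ← Finset.mul_sum, ← Complex.ofReal_sum,
    ← Complex.ofReal_sum, Finset.mul_sum, latDot, Finset.mul_sum]
  congr 4
  exact congrArg _ (funext fun i => by ring)

lemma gaussN_cos_re (N : ℕ) {s : ℝ} (hs : 0 < s) (h : ℝ) (ξ : EuclideanSpace ℝ (Fin N)) :
    ∑' k : Fin N → ℤ, Real.exp (-s * ∑ i, (k i : ℝ) ^ 2) * Real.cos (h * latDot N k ξ)
    = (∑' k : Fin N → ℤ, Complex.exp (((-s * ∑ i, (k i : ℝ) ^ 2 : ℝ) : ℂ) +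
      Complex.I * ((h * latDot N k ξ : ℝ) : ℂ))).re := by
  have hsum : Summable fun k : Fin N → ℤ => Complex.exp (((-s * ∑ i, (k i : ℝ) ^ 2 : ℝ) : ℂ) +
      Complex.I * ((h * latDot N k ξ : ℝ) : ℂ)) := by
    apply Summable.of_norm
    refine (summable_gaussN N hs).congr fun k => ?_
    rw [Complex.norm_exp, Complex.add_re, Complex.ofReal_re, Complex.re_mul_ofReal, Complex.I_re]
    simp
  rw [Complex.re_tsum hsum]
  refine tsum_congr fun k => ?_
  rw [Complex.exp_re]
  simp [-Complex.ofReal_mul, -Complex.ofReal_neg, -Complex.ofReal_sum]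

lemma gaussN_tendsto (N : ℕ) {u : ℝ} (hu : 0 < u) (ξ : EuclideanSpace ℝ (Fin N)) :
    Tendsto (fun h : ℝ => h ^ N * ∑' k : Fin N → ℤ,
      Real.exp (-(u * h ^ 2) * ∑ i, (k i : ℝ) ^ 2) * Real.cos (h * latDot N k ξ)) (𝓝[>] 0)
      (𝓝 (Real.sqrt (Real.pi / u) ^ N * Real.exp (-(‖ξ‖ ^ 2 / (4 * u))))) := by
  have h1 := tendsto_finsetProd (Finset.univ : Finset (Fin N))
    (fun i _ => poisson1_tendsto hu (ξ i))
  have h2 := (Complex.continuous_re.tendsto _).comp h1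
  have e : (∏ i : Fin N, ((Real.sqrt (Real.pi / u) * Real.exp (-(ξ i ^ 2 / (4 * u))) : ℝ) : ℂ)).re
      = Real.sqrt (Real.pi / u) ^ N * Real.exp (-(‖ξ‖ ^ 2 / (4 * u))) := by
    rw [← Complex.ofReal_prod, Complex.ofReal_re, Finset.prod_mul_distrib, ← Real.exp_sum,
      EuclideanSpace.real_norm_sq_eq, Finset.sum_neg_distrib, Finset.sum_div]
    simp
  rw [e] at h2
  refine h2.congr' ?_
  filter_upwards [self_mem_nhdsWithin] with h hh
  have hh : 0 < h := hh
  rw [gaussN_cos_re N (by positivity), gaussN_prod N (by positivity)]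
  simp only [Function.comp]
  rw [Finset.prod_mul_distrib, Finset.prod_const, Finset.card_univ, Fintype.card_fin,
    ← Complex.ofReal_pow, Complex.re_ofReal_mul]

lemma one_le_sq_of_ne {N : ℕ} {k : Fin N → ℤ} (hk : k ≠ 0) : (1 : ℝ) ≤ ∑ i, (k i : ℝ) ^ 2 := by
  obtain ⟨i, hi⟩ := Function.ne_iff.mp hk
  have : (1 : ℝ) ≤ (k i : ℝ) ^ 2 := by
    have : 1 ≤ (k i) ^ 2 := by
      have := pow_pos (abs_pos.mpr hi) 2
      rw [sq_abs] at this
      exact this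
    exact_mod_cast this
  exact this.trans (Finset.single_le_sum (f := fun i => (k i : ℝ) ^ 2)
    (fun i _ => sq_nonneg _) (Finset.mem_univ i))

lemma summable_gaussN' (N : ℕ) {s : ℝ} (hs : 0 < s) :
    Summable fun k : Fin N → ℤ => if k = 0 then 0 else Real.exp (-s * ∑ i, (k i : ℝ) ^ 2) := by
  refine Summable.of_nonneg_of_le (fun k => ?_) (fun k => ?_) (summable_gaussN N hs)
  · split_ifs <;> positivity
  · split_ifs
    · positivity
    · rfl

lemma gaussN_bound (N : ℕ) : ∃ C : ℝ, 0 ≤ C ∧ ∀ s : ℝ, 0 < s →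
    ∑' k : Fin N → ℤ, (if k = 0 then 0 else Real.exp (-s * ∑ i, (k i : ℝ) ^ 2))
      ≤ C * s ^ (-((N : ℝ) / 2)) * min 1 s⁻¹ := by
  set A := ∑' n : ℤ, Real.exp (-Real.pi ^ 2 * (n : ℝ) ^ 2) with hA
  set B := ∑' k : Fin N → ℤ, Real.exp (-1 * ∑ i, (k i : ℝ) ^ 2) with hB
  have hA0 : 0 ≤ A := tsum_nonneg fun _ => (Real.exp_pos _).le
  have hB0 : 0 ≤ B := tsum_nonneg fun _ => (Real.exp_pos _).le
  refine ⟨(Real.sqrt Real.pi * A) ^ N + Real.exp 1 * B * (N + 1).factorial, by positivity, ?_⟩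
  intro s hs
  have hrp : 0 < s ^ (-((N : ℝ) / 2)) := Real.rpow_pos_of_pos hs _
  rcases le_total s 1 with h1 | h1
  · rw [min_eq_left ((one_le_inv₀ hs).mpr h1), mul_one]
    have e1 : ∑' k : Fin N → ℤ, (if k = 0 then 0 else Real.exp (-s * ∑ i, (k i : ℝ) ^ 2))
        ≤ ∑' k : Fin N → ℤ, Real.exp (-s * ∑ i, (k i : ℝ) ^ 2) := by
      refine (summable_gaussN' N hs).tsum_le_tsum (fun k => ?_) (summable_gaussN N hs)
      split_ifs
      · positivity
      · rfl
    have e2 : ∑' k : Fin N → ℤ, Real.exp (-s * ∑ i, (k i : ℝ) ^ 2)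
        = (Real.sqrt (Real.pi / s) * ∑' n : ℤ, Real.exp (-((2 * Real.pi * n - 0) ^ 2 / (4 * s)))) ^ N := by
      have a1 := gaussN_cos_re N hs 0 0
      rw [gaussN_prod N hs] at a1
      simp_rw [zero_mul, Real.cos_zero, mul_one] at a1
      rw [a1]
      have a2 := poisson1 hs 0
      simp_rw [zero_mul] at a2
      rw [a2, Finset.prod_const, ← Complex.ofReal_pow, Complex.ofReal_re, Finset.card_univ,
        Fintype.card_fin]
    have e3 : ∑' n : ℤ, Real.exp (-((2 * Real.pi * n - 0) ^ 2 / (4 * s))) ≤ A := by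
      have e4 : ∀ n : ℤ, -((2 * Real.pi * n - 0) ^ 2 / (4 * s)) = -(Real.pi ^ 2 / s) * (n : ℝ) ^ 2 := by
        intro n; field_simp; ring
      simp_rw [e4]
      refine (summable_gauss1 (by positivity)).tsum_le_tsum (fun k => ?_)
        (summable_gauss1 (by positivity))
      rw [Real.exp_le_exp]
      gcongr
      rw [le_div_iff₀ hs]
      nlinarith [sq_nonneg Real.pi]
    have e5 : Real.sqrt (Real.pi / s) ^ N = Real.sqrt Real.pi ^ N * s ^ (-((N : ℝ) / 2)) := by
      rw [Real.sqrt_div (by positivity), div_pow, Real.rpow_neg hs.le, div_eq_mul_inv,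
        Real.sqrt_eq_rpow s, ← Real.rpow_natCast (s ^ (1 / 2 : ℝ)), ← Real.rpow_mul hs.le]
      congr 3
      ring
    have e6 : 0 ≤ ∑' n : ℤ, Real.exp (-((2 * Real.pi * n - 0) ^ 2 / (4 * s))) :=
      tsum_nonneg fun _ => (Real.exp_pos _).le
    calc _ ≤ _ := e1
      _ = _ := e2
      _ ≤ (Real.sqrt (Real.pi / s) * A) ^ N := by gcongr
      _ = (Real.sqrt Real.pi * A) ^ N * s ^ (-((N : ℝ) / 2)) := by
        rw [mul_pow, e5, mul_pow]; ring
      _ ≤ _ := by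
        gcongr
        have : 0 ≤ Real.exp 1 * B * (N + 1).factorial := by positivity
        linarith
  · rw [min_eq_right (inv_le_one_of_one_le₀ h1)]
    have e1 : ∑' k : Fin N → ℤ, (if k = 0 then 0 else Real.exp (-s * ∑ i, (k i : ℝ) ^ 2))
        ≤ ∑' k : Fin N → ℤ, Real.exp (1 - s) * Real.exp (-1 * ∑ i, (k i : ℝ) ^ 2) := by
      refine (summable_gaussN' N hs).tsum_le_tsum (fun k => ?_)
        ((summable_gaussN N one_pos).mul_left _)
      split_ifs with hk
      · positivity
      · rw [← Real.exp_add, Real.exp_le_exp]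
        have := one_le_sq_of_ne hk
        nlinarith
    rw [tsum_mul_left] at e1
    have e2 : Real.exp (1 - s) ≤ Real.exp 1 * ((N + 1).factorial * (s ^ (-((N : ℝ) / 2)) * s⁻¹)) := by
      rw [Real.exp_sub, div_eq_mul_inv]
      gcongr
      have a1 := Real.pow_div_factorial_le_exp s hs.le (N + 1)
      have a2 : s ^ ((N : ℝ) / 2) ≤ s ^ N := by
        rw [← Real.rpow_natCast]
        exact Real.rpow_le_rpow_of_exponent_le h1 (by linarith [(Nat.cast_nonneg N : (0 : ℝ) ≤ N)])
      have a3 : 0 < s ^ ((N : ℝ) / 2) := Real.rpow_pos_of_pos hs _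
      rw [Real.rpow_neg hs.le, ← mul_inv, ← div_eq_mul_inv,
        inv_le_comm₀ (Real.exp_pos _) (by positivity), inv_div]
      refine le_trans ?_ a1
      gcongr
      rw [pow_succ]
      gcongr
    calc _ ≤ _ := e1
      _ ≤ Real.exp 1 * ((N + 1).factorial * (s ^ (-((N : ℝ) / 2)) * s⁻¹)) * B := by gcongr
      _ = (Real.exp 1 * B * (N + 1).factorial) * s ^ (-((N : ℝ) / 2)) * s⁻¹ := by ring
      _ ≤ _ := by
        gcongr
        have : 0 ≤ (Real.sqrt Real.pi * A) ^ N := by positivity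
        linarith

/-- Gaussian lattice sum with weight `c`. -/
noncomputable def PhiC (N : ℕ) (c : (Fin N → ℤ) → ℝ) (h u : ℝ) : ℝ :=
  h ^ N * ∑' k : Fin N → ℤ, Real.exp (-(u * h ^ 2) * ∑ i, (k i : ℝ) ^ 2) * c k

lemma summable_gaussN_mul (N : ℕ) {s : ℝ} (hs : 0 < s) (c : (Fin N → ℤ) → ℝ)
    (hc : ∀ k, |c k| ≤ 2) :
    Summable fun k : Fin N → ℤ => Real.exp (-s * ∑ i, (k i : ℝ) ^ 2) * c k := by
  apply Summable.of_norm_bounded ((summable_gaussN N hs).mul_right 2)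
  intro k
  rw [norm_mul, Real.norm_eq_abs, Real.norm_eq_abs, abs_of_pos (Real.exp_pos _)]
  gcongr
  exact hc k

/-- The weight `1 - cos (h k·ξ)`. -/
noncomputable def cw (N : ℕ) (ξ : EuclideanSpace ℝ (Fin N)) (h : ℝ) (k : Fin N → ℤ) : ℝ :=
  1 - Real.cos (h * latDot N k ξ)

/-- The weight `1` off the origin. -/
noncomputable def ow (N : ℕ) (k : Fin N → ℤ) : ℝ := if k = 0 then 0 else 1

lemma cw_nonneg (N : ℕ) (ξ : EuclideanSpace ℝ (Fin N)) (h : ℝ) (k : Fin N → ℤ) :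
    0 ≤ cw N ξ h k := by
  unfold cw; linarith [Real.cos_le_one (h * latDot N k ξ)]

lemma cw_le (N : ℕ) (ξ : EuclideanSpace ℝ (Fin N)) (h : ℝ) (k : Fin N → ℤ) :
    cw N ξ h k ≤ 2 := by
  unfold cw; linarith [Real.neg_one_le_cos (h * latDot N k ξ)]

lemma cw_zero (N : ℕ) (ξ : EuclideanSpace ℝ (Fin N)) (h : ℝ) : cw N ξ h 0 = 0 := by
  simp [cw, latDot]

lemma cw_le_sq (N : ℕ) (ξ : EuclideanSpace ℝ (Fin N)) (h : ℝ) (k : Fin N → ℤ) :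
    cw N ξ h k ≤ h ^ 2 * (∑ i, (k i : ℝ) ^ 2) * ‖ξ‖ ^ 2 / 2 := by
  have h1 := Real.one_sub_sq_div_two_le_cos (x := h * latDot N k ξ)
  have h2 : (latDot N k ξ) ^ 2 ≤ (∑ i, (k i : ℝ) ^ 2) * ‖ξ‖ ^ 2 := by
    rw [EuclideanSpace.real_norm_sq_eq, latDot]
    exact Finset.sum_mul_sq_le_sq_mul_sq _ _ _
  unfold cw
  have h3 := mul_le_mul_of_nonneg_left h2 (sq_nonneg h)
  rw [mul_pow] at h1
  linarith

lemma Phi_tendsto (N : ℕ) {u : ℝ} (hu : 0 < u) (ξ : EuclideanSpace ℝ (Fin N)) :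
    Tendsto (fun h : ℝ => PhiC N (cw N ξ h) h u) (𝓝[>] 0)
      (𝓝 (Real.sqrt (Real.pi / u) ^ N * (1 - Real.exp (-(‖ξ‖ ^ 2 / (4 * u)))))) := by
  have h1 := gaussN_tendsto N hu ξ
  have h0 := gaussN_tendsto N hu (0 : EuclideanSpace ℝ (Fin N))
  have := h0.sub h1
  simp only [norm_zero] at this
  have e : Real.sqrt (Real.pi / u) ^ N * Real.exp (-((0 : ℝ) ^ 2 / (4 * u))) -
      Real.sqrt (Real.pi / u) ^ N * Real.exp (-(‖ξ‖ ^ 2 / (4 * u)))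
      = Real.sqrt (Real.pi / u) ^ N * (1 - Real.exp (-(‖ξ‖ ^ 2 / (4 * u)))) := by
    simp; ring
  rw [e] at this
  refine this.congr' ?_
  filter_upwards [self_mem_nhdsWithin] with h hh
  have hh : 0 < h := hh
  rw [PhiC, ← mul_sub, ← Summable.tsum_sub]
  · congr 1
    refine tsum_congr fun k => ?_
    simp [cw, latDot]; ring
  · exact summable_gaussN_mul N (by positivity) _ (fun k => (Real.abs_cos_le_one _).trans (by norm_num))
  · exact summable_gaussN_mul N (by positivity) _ (fun k => (Real.abs_cos_le_one _).trans (by norm_num))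

lemma scale_aux (N : ℕ) {h u r : ℝ} (hh : 0 < h) (hu : 0 < u) (hr : 0 < r) :
    h ^ N * (r * (u * h ^ 2)) ^ (-((N : ℝ) / 2)) = r ^ (-((N : ℝ) / 2)) * u ^ (-((N : ℝ) / 2)) := by
  rw [Real.mul_rpow hr.le (by positivity), Real.mul_rpow hu.le (by positivity),
    ← Real.rpow_natCast h 2, ← Real.rpow_mul hh.le,
    show ((2 : ℕ) : ℝ) * (-((N : ℝ) / 2)) = -(N : ℝ) by push_cast; ring, Real.rpow_neg hh.le,
    Real.rpow_natCast]
  field_simp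

lemma Phi_bound (N : ℕ) (ξ : EuclideanSpace ℝ (Fin N)) : ∃ C : ℝ, 0 ≤ C ∧ ∀ h u : ℝ, 0 < h → 0 < u →
    PhiC N (cw N ξ h) h u ≤ C * (u ^ (-((N : ℝ) / 2)) * min 1 u⁻¹) := by
  obtain ⟨C, hC, hb⟩ := gaussN_bound N
  refine ⟨2 * C + ‖ξ‖ ^ 2 * (C * (1 / 2 : ℝ) ^ (-((N : ℝ) / 2))), by positivity, ?_⟩
  intro h u hh hu
  have hrp : 0 < u ^ (-((N : ℝ) / 2)) := Real.rpow_pos_of_pos hu _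
  have hsm := summable_gaussN_mul N (s := u * h ^ 2) (by positivity) (cw N ξ h)
    (fun k => by rw [abs_of_nonneg (cw_nonneg N ξ h k)]; exact cw_le N ξ h k)
  have b1 : PhiC N (cw N ξ h) h u ≤ 2 * C * u ^ (-((N : ℝ) / 2)) := by
    have e1 : ∑' k : Fin N → ℤ, Real.exp (-(u * h ^ 2) * ∑ i, (k i : ℝ) ^ 2) * cw N ξ h k
        ≤ ∑' k : Fin N → ℤ, (if k = 0 then 0 else
          Real.exp (-(u * h ^ 2) * ∑ i, (k i : ℝ) ^ 2)) * 2 := by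
      refine hsm.tsum_le_tsum (fun k => ?_) ((summable_gaussN' N (by positivity)).mul_right 2)
      split_ifs with hk
      · rw [hk, cw_zero]; simp
      · gcongr; exact cw_le N ξ h k
    rw [tsum_mul_right] at e1
    have e2 := hb (u * h ^ 2) (by positivity)
    have e3 := scale_aux N hh hu one_pos
    rw [one_mul, Real.one_rpow, one_mul] at e3
    have e4 : 0 < (u * h ^ 2) ^ (-((N : ℝ) / 2)) := Real.rpow_pos_of_pos (by positivity) _
    unfold PhiC
    calc _ ≤ h ^ N * ((C * (u * h ^ 2) ^ (-((N : ℝ) / 2)) * 1) * 2) := by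
          gcongr
          refine e1.trans ?_
          gcongr
          refine e2.trans ?_
          gcongr
          exact min_le_left _ _
      _ = 2 * C * (h ^ N * (u * h ^ 2) ^ (-((N : ℝ) / 2))) := by ring
      _ = _ := by rw [e3]
  have b2 : PhiC N (cw N ξ h) h u ≤
      ‖ξ‖ ^ 2 * (C * (1 / 2 : ℝ) ^ (-((N : ℝ) / 2))) * u ^ (-((N : ℝ) / 2)) * u⁻¹ := by
    have e1 : ∑' k : Fin N → ℤ, Real.exp (-(u * h ^ 2) * ∑ i, (k i : ℝ) ^ 2) * cw N ξ h k
        ≤ ∑' k : Fin N → ℤ, (if k = 0 then 0 else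
          Real.exp (-(1 / 2 * (u * h ^ 2)) * ∑ i, (k i : ℝ) ^ 2)) * (‖ξ‖ ^ 2 * u⁻¹) := by
      refine hsm.tsum_le_tsum (fun k => ?_) ((summable_gaussN' N (by positivity)).mul_right _)
      split_ifs with hk
      · rw [hk, cw_zero]; simp
      · have a0 := cw_le_sq N ξ h k
        set S := ∑ i, (k i : ℝ) ^ 2 with hS
        have a1 := Real.add_one_le_exp (1 / 2 * (u * h ^ 2) * S)
        have a3 : cw N ξ h k ≤ Real.exp (1 / 2 * (u * h ^ 2) * S) * (‖ξ‖ ^ 2 * u⁻¹) := by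
          refine a0.trans ?_
          calc h ^ 2 * S * ‖ξ‖ ^ 2 / 2 = (1 / 2 * (u * h ^ 2) * S) * (‖ξ‖ ^ 2 * u⁻¹) := by
                field_simp
            _ ≤ _ := by gcongr; linarith
        calc _ ≤ Real.exp (-(u * h ^ 2) * S) *
              (Real.exp (1 / 2 * (u * h ^ 2) * S) * (‖ξ‖ ^ 2 * u⁻¹)) := by gcongr
          _ = _ := by
            rw [← mul_assoc, ← Real.exp_add]; congr 2; ring
    rw [tsum_mul_right] at e1
    have e2 := hb (1 / 2 * (u * h ^ 2)) (by positivity)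
    have e3 := scale_aux N hh hu (r := 1 / 2) (by norm_num)
    have e4 : 0 < (1 / 2 * (u * h ^ 2)) ^ (-((N : ℝ) / 2)) := Real.rpow_pos_of_pos (by positivity) _
    unfold PhiC
    calc _ ≤ h ^ N * ((C * (1 / 2 * (u * h ^ 2)) ^ (-((N : ℝ) / 2)) * 1) * (‖ξ‖ ^ 2 * u⁻¹)) := by
          gcongr
          refine e1.trans ?_
          gcongr
          refine e2.trans ?_
          gcongr
          exact min_le_left _ _
      _ = C * (h ^ N * (1 / 2 * (u * h ^ 2)) ^ (-((N : ℝ) / 2))) * (‖ξ‖ ^ 2 * u⁻¹) := by ring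
      _ = _ := by rw [e3]; ring
  have n1 : 0 ≤ ‖ξ‖ ^ 2 * (C * (1 / 2 : ℝ) ^ (-((N : ℝ) / 2))) := by positivity
  rcases min_cases 1 u⁻¹ with ⟨hm, _⟩ | ⟨hm, _⟩
  · rw [hm, mul_one]
    refine b1.trans ?_
    gcongr
    linarith
  · rw [hm, ← mul_assoc]
    refine b2.trans ?_
    gcongr
    linarith

lemma Phi_ow_bound (N : ℕ) {h : ℝ} (hh : 0 < h) : ∃ C : ℝ, 0 ≤ C ∧ ∀ u : ℝ, 0 < u →
    PhiC N (ow N) h u ≤ C * (u ^ (-((N : ℝ) / 2)) * min 1 u⁻¹) := by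
  obtain ⟨C, hC, hb⟩ := gaussN_bound N
  refine ⟨C * (1 + (h ^ 2)⁻¹), by positivity, ?_⟩
  intro u hu
  have hrp : 0 < u ^ (-((N : ℝ) / 2)) := Real.rpow_pos_of_pos hu _
  have e1 : ∑' k : Fin N → ℤ, Real.exp (-(u * h ^ 2) * ∑ i, (k i : ℝ) ^ 2) * ow N k
      = ∑' k : Fin N → ℤ, (if k = 0 then 0 else
          Real.exp (-(u * h ^ 2) * ∑ i, (k i : ℝ) ^ 2)) := by
    refine tsum_congr fun k => ?_
    unfold ow
    split_ifs <;> simp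
  have e3 := scale_aux N hh hu one_pos
  rw [one_mul, Real.one_rpow, one_mul] at e3
  rw [PhiC, e1]
  calc _ ≤ h ^ N * (C * (u * h ^ 2) ^ (-((N : ℝ) / 2)) * min 1 (u * h ^ 2)⁻¹) := by
        gcongr; exact hb _ (by positivity)
    _ = C * (u ^ (-((N : ℝ) / 2))) * min 1 (u * h ^ 2)⁻¹ := by rw [← e3]; ring
    _ ≤ C * (u ^ (-((N : ℝ) / 2))) * ((1 + (h ^ 2)⁻¹) * min 1 u⁻¹) := by
        gcongr
        have p : 0 < (h ^ 2)⁻¹ := by positivity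
        have q : 0 < u⁻¹ := by positivity
        rw [mul_inv]
        rcases min_cases 1 u⁻¹ with ⟨hm, _⟩ | ⟨hm, _⟩
        · rw [hm]
          refine (min_le_left _ _).trans ?_
          linarith
        · rw [hm]
          refine (min_le_right _ _).trans ?_
          nlinarith
    _ = _ := by ring

lemma lint_gamma {p r : ℝ} (hp : 0 < p) (hr : 0 < r) :
    ∫⁻ u in Set.Ioi (0 : ℝ), ENNReal.ofReal (u ^ (p - 1) * Real.exp (-(r * u)))
      = ENNReal.ofReal ((1 / r) ^ p * Real.Gamma p) := by
  have h := Real.integral_rpow_mul_exp_neg_mul_Ioi hp hr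
  have hpos : 0 < (1 / r) ^ p * Real.Gamma p :=
    mul_pos (Real.rpow_pos_of_pos (by positivity) _) (Real.Gamma_pos_of_pos hp)
  rw [← h, ofReal_integral_eq_lintegral_ofReal]
  · by_contra hc
    rw [integral_undef hc] at h
    linarith
  · filter_upwards [self_mem_ae_restrict measurableSet_Ioi] with u hu
    have : 0 ≤ u ^ (p - 1) := Real.rpow_nonneg (le_of_lt hu) _
    positivity

lemma lint_inv_gamma {α w : ℝ} (hα : α < 2) (hw : 0 < w) :
    ∫⁻ u in Set.Ioi (0 : ℝ), ENNReal.ofReal (u ^ (α / 2 - 2) * Real.exp (-(w / u)))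
      = ENNReal.ofReal (Real.Gamma (1 - α / 2) * w ^ (α / 2 - 1)) := by
  have hp : 0 < 1 - α / 2 := by linarith
  have h := Real.integral_rpow_mul_exp_neg_mul_Ioi hp hw
  have h2 := integral_comp_rpow_Ioi
    (fun v : ℝ => v ^ (1 - α / 2 - 1) * Real.exp (-(w * v))) (p := -1) (by norm_num)
  rw [h] at h2
  have h3 : ∫ u in Set.Ioi (0 : ℝ), u ^ (α / 2 - 2) * Real.exp (-(w / u))
      = (1 / w) ^ (1 - α / 2) * Real.Gamma (1 - α / 2) := by
    rw [← h2]
    refine setIntegral_congr_fun measurableSet_Ioi fun u hu => ?_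
    have hu : 0 < u := hu
    simp only [abs_neg, abs_one, one_mul, smul_eq_mul]
    rw [← Real.rpow_mul hu.le, Real.rpow_neg_one, ← mul_assoc, ← Real.rpow_add hu]
    congr 2
    ring
  have hpos : 0 < (1 / w) ^ (1 - α / 2) * Real.Gamma (1 - α / 2) :=
    mul_pos (Real.rpow_pos_of_pos (by positivity) _) (Real.Gamma_pos_of_pos hp)
  have e : Real.Gamma (1 - α / 2) * w ^ (α / 2 - 1) =
      (1 / w) ^ (1 - α / 2) * Real.Gamma (1 - α / 2) := by
    rw [one_div, Real.inv_rpow hw.le, ← Real.rpow_neg hw.le, mul_comm]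
    congr 2
    ring
  rw [e, ← h3, ofReal_integral_eq_lintegral_ofReal]
  · by_contra hc
    rw [integral_undef hc] at h3
    linarith
  · filter_upwards [self_mem_ae_restrict measurableSet_Ioi] with u hu
    have : 0 ≤ u ^ (α / 2 - 2) := Real.rpow_nonneg (le_of_lt hu) _
    positivity

lemma one_sub_exp_lint {q u : ℝ} (hq : 0 ≤ q) (hu : 0 < u) :
    ENNReal.ofReal (1 - Real.exp (-(q / u)))
      = ∫⁻ w in Set.Ioc 0 q, ENNReal.ofReal (u⁻¹ * Real.exp (-(w / u))) := by
  have hd : ∀ w ∈ Set.uIcc 0 q, HasDerivAt (fun w => -Real.exp (-(w / u)))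
      (u⁻¹ * Real.exp (-(w / u))) w := by
    intro w _
    have h1 : HasDerivAt (fun w : ℝ => -(w / u)) (-(1 / u)) w := ((hasDerivAt_id w).div_const u).neg
    have h2 : HasDerivAt (fun w => -Real.exp (-(w / u)))
      (-(Real.exp (-(w / u)) * (-(1 / u)))) w := h1.exp.neg
    have e : u⁻¹ * Real.exp (-(w / u)) = -(Real.exp (-(w / u)) * (-(1 / u))) := by ring
    rw [e]
    exact h2
  have hc : Continuous fun w => u⁻¹ * Real.exp (-(w / u)) := by fun_prop
  have h := intervalIntegral.integral_eq_sub_of_hasDerivAt hd (hc.intervalIntegrable _ _)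
  have e : (1 - Real.exp (-(q / u))) = ∫ w in (0 : ℝ)..q, u⁻¹ * Real.exp (-(w / u)) := by
    rw [h]; simp; ring
  rw [e, intervalIntegral.integral_of_le hq, ofReal_integral_eq_lintegral_ofReal]
  · exact (hc.intervalIntegrable 0 q).1
  · exact ae_of_all _ fun w => by positivity

lemma lint_limit {α q : ℝ} (hα0 : 0 < α) (hα : α < 2) (hq : 0 ≤ q) :
    ∫⁻ u in Set.Ioi (0 : ℝ), ENNReal.ofReal (u ^ (α / 2 - 1) * (1 - Real.exp (-(q / u))))
      = ENNReal.ofReal (Real.Gamma (1 - α / 2) * (q ^ (α / 2) / (α / 2))) := by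
  have hG : 0 < Real.Gamma (1 - α / 2) := Real.Gamma_pos_of_pos (by linarith)
  calc _ = ∫⁻ u in Set.Ioi (0 : ℝ), ∫⁻ w in Set.Ioc 0 q,
          ENNReal.ofReal (u ^ (α / 2 - 2) * Real.exp (-(w / u))) := by
        refine setLIntegral_congr_fun measurableSet_Ioi fun u hu => ?_
        have hu : 0 < u := hu
        have hup : 0 ≤ u ^ (α / 2 - 1) := Real.rpow_nonneg hu.le _
        rw [ENNReal.ofReal_mul hup, one_sub_exp_lint hq hu, ← lintegral_const_mul _ (by fun_prop)]
        refine lintegral_congr fun w => ?_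
        rw [← ENNReal.ofReal_mul hup, ← mul_assoc]
        congr 2
        rw [← Real.rpow_neg_one u, ← Real.rpow_add hu]
        congr 1
        ring
    _ = ∫⁻ w in Set.Ioc 0 q, ∫⁻ u in Set.Ioi (0 : ℝ),
          ENNReal.ofReal (u ^ (α / 2 - 2) * Real.exp (-(w / u))) := by
        refine lintegral_lintegral_swap ?_
        apply Measurable.aemeasurable
        simp only [Function.uncurry_def]
        fun_prop
    _ = ∫⁻ w in Set.Ioc 0 q, ENNReal.ofReal (Real.Gamma (1 - α / 2) * w ^ (α / 2 - 1)) := by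
        refine setLIntegral_congr_fun measurableSet_Ioc fun w hw => ?_
        exact lint_inv_gamma hα hw.1
    _ = ENNReal.ofReal (∫ w in Set.Ioc 0 q, Real.Gamma (1 - α / 2) * w ^ (α / 2 - 1)) := by
        rw [ofReal_integral_eq_lintegral_ofReal]
        · exact ((intervalIntegral.intervalIntegrable_rpow' (a := 0) (b := q)
            (r := α / 2 - 1) (by linarith)).const_mul _).1
        · filter_upwards [self_mem_ae_restrict measurableSet_Ioc] with w hw
          have : 0 ≤ w ^ (α / 2 - 1) := Real.rpow_nonneg hw.1.le _
          positivity
    _ = _ := by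
        rw [← intervalIntegral.integral_of_le hq, intervalIntegral.integral_const_mul,
          integral_rpow (Or.inl (by linarith)), Real.zero_rpow (by linarith)]
        congr 3
        · ring_nf
        · ring

lemma lint_min {α : ℝ} (hα0 : 0 < α) (hα : α < 2) :
    ∫⁻ u in Set.Ioi (0 : ℝ), ENNReal.ofReal (u ^ (α / 2 - 1) * min 1 u⁻¹)
      ≤ ENNReal.ofReal (2 / α + 2 / (2 - α)) := by
  have h2 : 0 < 2 - α := by linarith
  rw [← Set.Ioc_union_Ioi_eq_Ioi (zero_le_one' ℝ), lintegral_union measurableSet_Ioi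
    (Set.Ioc_disjoint_Ioi le_rfl), ENNReal.ofReal_add (by positivity) (by positivity)]
  gcongr
  · calc _ ≤ ∫⁻ u in Set.Ioc (0 : ℝ) 1, ENNReal.ofReal (u ^ (α / 2 - 1)) := by
          refine setLIntegral_mono' measurableSet_Ioc fun u hu => ?_
          apply ENNReal.ofReal_le_ofReal
          exact mul_le_of_le_one_right (Real.rpow_nonneg hu.1.le _) (min_le_left _ _)
      _ = ENNReal.ofReal (∫ u in Set.Ioc (0 : ℝ) 1, u ^ (α / 2 - 1)) := by
          rw [ofReal_integral_eq_lintegral_ofReal]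
          · exact (intervalIntegral.intervalIntegrable_rpow' (by linarith)).1
          · filter_upwards [self_mem_ae_restrict measurableSet_Ioc] with w hw
            exact Real.rpow_nonneg hw.1.le _
      _ = _ := by
          rw [← intervalIntegral.integral_of_le zero_le_one,
            integral_rpow (Or.inl (by linarith)), Real.zero_rpow (by linarith), Real.one_rpow]
          congr 1
          rw [sub_add_cancel, sub_zero, one_div_div]
      _ ≤ _ := le_rfl
  · calc _ ≤ ∫⁻ u in Set.Ioi (1 : ℝ), ENNReal.ofReal (u ^ (α / 2 - 2)) := by
          refine setLIntegral_mono' measurableSet_Ioi fun u hu => ?_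
          have hu : 0 < u := lt_trans one_pos hu
          apply ENNReal.ofReal_le_ofReal
          calc _ ≤ u ^ (α / 2 - 1) * u⁻¹ :=
                mul_le_mul_of_nonneg_left (min_le_right _ _) (Real.rpow_nonneg hu.le _)
            _ = _ := by
                rw [← Real.rpow_neg_one u, ← Real.rpow_add hu]
                congr 1
                ring
      _ = ENNReal.ofReal (∫ u in Set.Ioi (1 : ℝ), u ^ (α / 2 - 2)) := by
          rw [ofReal_integral_eq_lintegral_ofReal]
          · exact integrableOn_Ioi_rpow_of_lt (by linarith) one_pos
          · filter_upwards [self_mem_ae_restrict measurableSet_Ioi] with w hw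
            exact Real.rpow_nonneg (le_trans zero_le_one (le_of_lt hw)) _
      _ = _ := by
          rw [integral_Ioi_rpow_of_lt (by linarith) one_pos, Real.one_rpow]
          congr 1
          have h3 : α / 2 - 2 + 1 ≠ 0 := by linarith
          rw [div_eq_div_iff h3 h2.ne']
          ring
      _ ≤ _ := le_rfl

/-- `b(α)` without the Gamma factor in the dimension. -/
noncomputable def beta' (N : ℕ) (α : ℝ) : ℝ :=
  2 * Real.Gamma (α / 2 + 1) * Real.sin (α * Real.pi / 2) /
    (2 ^ ((2 : ℝ) - α) * Real.pi ^ (1 + (N : ℝ) / 2))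

lemma bConst_eq (N : ℕ) {α : ℝ} (hα : 0 ≤ α) :
    bConst N α = beta' N α * Real.Gamma (((N : ℝ) + α) / 2) := by
  unfold bConst beta'
  rcases hα.eq_or_lt with h | h
  · subst h; simp
  · rw [Real.Gamma_add_one (by positivity)]
    ring

lemma sin_nonneg_aux {α : ℝ} (h0 : 0 ≤ α) (h2 : α ≤ 2) : 0 ≤ Real.sin (α * Real.pi / 2) := by
  have := Real.pi_pos
  apply Real.sin_nonneg_of_nonneg_of_le_pi
  · positivity
  · nlinarith

lemma beta'_nonneg (N : ℕ) {α : ℝ} (h0 : 0 ≤ α) (h2 : α ≤ 2) : 0 ≤ beta' N α := by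
  have h := sin_nonneg_aux h0 h2
  have : 0 < Real.Gamma (α / 2 + 1) := Real.Gamma_pos_of_pos (by positivity)
  unfold beta'
  positivity

lemma continuousOn_Gamma_pos : ContinuousOn Real.Gamma (Set.Ioi 0) := by
  intro x hx
  refine (Real.differentiableAt_Gamma fun m => ?_).continuousAt.continuousWithinAt
  have : 0 < x := hx
  have : (0 : ℝ) ≤ m := Nat.cast_nonneg m
  linarith

lemma beta'_cont (N : ℕ) : ContinuousOn (beta' N) (Set.Icc 0 2) := by
  unfold beta'
  refine ContinuousOn.div ?_ ?_ ?_
  · refine ContinuousOn.mul (continuousOn_const.mul ?_) (by fun_prop)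
    refine continuousOn_Gamma_pos.comp (by fun_prop) fun α hα => ?_
    have := hα.1
    simp only [Set.mem_Ioi]; linarith
  · refine ContinuousOn.mul ?_ continuousOn_const
    exact ContinuousOn.rpow continuousOn_const (by fun_prop) fun _ _ => Or.inl (by norm_num)
  · intro α _
    positivity

lemma bConst_cont (N : ℕ) (hN : 1 ≤ N) : ContinuousOn (bConst N) (Set.Icc 0 2) := by
  have : ContinuousOn (fun α => beta' N α * Real.Gamma (((N : ℝ) + α) / 2)) (Set.Icc 0 2) := by
    refine (beta'_cont N).mul ?_
    refine continuousOn_Gamma_pos.comp (by fun_prop) fun α hα => ?_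
    have := hα.1
    have : (1 : ℝ) ≤ N := by exact_mod_cast hN
    simp only [Set.mem_Ioi]; linarith
  exact this.congr fun α hα => bConst_eq N hα.1

lemma bConst_nonneg (N : ℕ) (hN : 1 ≤ N) {α : ℝ} (h0 : 0 ≤ α) (h2 : α ≤ 2) : 0 ≤ bConst N α := by
  rw [bConst_eq N h0]
  have : (1 : ℝ) ≤ N := by exact_mod_cast hN
  exact mul_nonneg (beta'_nonneg N h0 h2) (Real.Gamma_pos_of_pos (by linarith)).le

lemma beta'_bound (N : ℕ) : ∃ M : ℝ, 0 ≤ M ∧ ∀ α ∈ Set.Ioo (0 : ℝ) 2,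
    beta' N α * (2 / α + 2 / (2 - α)) ≤ M := by
  have hc : ContinuousOn (fun α : ℝ => Real.Gamma (α / 2 + 1)) (Set.Icc 0 2) := by
    refine continuousOn_Gamma_pos.comp (by fun_prop) fun α hα => ?_
    have := hα.1
    simp only [Set.mem_Ioi]; linarith
  obtain ⟨G, hG⟩ := isCompact_Icc.exists_bound_of_continuousOn hc
  have hG0 : 0 ≤ G := (norm_nonneg _).trans (hG 0 (by norm_num))
  refine ⟨2 * G * (2 * Real.pi), by positivity, ?_⟩
  intro α ⟨h0, h2⟩
  have h2' : 0 < 2 - α := by linarith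
  have hp := Real.pi_gt_three
  have hs := sin_nonneg_aux h0.le h2.le
  have s1 : Real.sin (α * Real.pi / 2) ≤ α * Real.pi / 2 := Real.sin_le (by positivity)
  have s2 : Real.sin (α * Real.pi / 2) ≤ (2 - α) * Real.pi / 2 := by
    rw [← Real.sin_pi_sub]
    have := Real.sin_le (x := Real.pi - α * Real.pi / 2) (by nlinarith)
    linarith
  have g1 : Real.Gamma (α / 2 + 1) ≤ G := (le_abs_self _).trans (hG α ⟨h0.le, h2.le⟩)
  have g0 : 0 < Real.Gamma (α / 2 + 1) := Real.Gamma_pos_of_pos (by positivity)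
  have d1 : (1 : ℝ) ≤ 2 ^ ((2 : ℝ) - α) * Real.pi ^ (1 + (N : ℝ) / 2) := by
    have a := Real.one_le_rpow (x := 2) (z := 2 - α) (by norm_num) h2'.le
    have b := Real.one_le_rpow (x := Real.pi) (z := 1 + (N : ℝ) / 2) (by linarith) (by positivity)
    nlinarith
  have b1 : beta' N α ≤ 2 * G * Real.sin (α * Real.pi / 2) := by
    unfold beta'
    refine (div_le_self (by positivity) d1).trans ?_
    gcongr
  have t1 : Real.sin (α * Real.pi / 2) * (2 / α) ≤ Real.pi := by
    rw [mul_div_assoc', div_le_iff₀ h0]; linarith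
  have t2 : Real.sin (α * Real.pi / 2) * (2 / (2 - α)) ≤ Real.pi := by
    rw [mul_div_assoc', div_le_iff₀ h2']; linarith
  calc _ ≤ 2 * G * Real.sin (α * Real.pi / 2) * (2 / α + 2 / (2 - α)) := by gcongr
    _ = 2 * G * (Real.sin (α * Real.pi / 2) * (2 / α) + Real.sin (α * Real.pi / 2) * (2 / (2 - α))) := by
      ring
    _ ≤ 2 * G * (Real.pi + Real.pi) := by gcongr
    _ = _ := by ring

lemma const_eq (N : ℕ) {α x : ℝ} (h0 : 0 < α) (h2 : α < 2) (hx : 0 ≤ x) :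
    beta' N α * (Real.sqrt Real.pi ^ N *
      (Real.Gamma (1 - α / 2) * ((x ^ 2 / 4) ^ (α / 2) / (α / 2)))) = x ^ α / 2 := by
  have hr := Real.Gamma_mul_Gamma_one_sub (α / 2)
  have hsin : 0 < Real.sin (Real.pi * (α / 2)) := by
    have := Real.pi_pos
    apply Real.sin_pos_of_pos_of_lt_pi
    · positivity
    · nlinarith
  rw [eq_div_iff hsin.ne'] at hr
  have e1 : (x ^ 2 / 4) ^ (α / 2) = x ^ α * (2 ^ α)⁻¹ := by
    rw [show x ^ 2 / 4 = (x / 2) ^ (2 : ℝ) by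
        rw [show (2 : ℝ) = ((2 : ℕ) : ℝ) by norm_num, Real.rpow_natCast]; push_cast; ring,
      ← Real.rpow_mul (by positivity), show 2 * (α / 2) = α by ring,
      Real.div_rpow hx (by norm_num), div_eq_mul_inv]
  have e2 : Real.pi ^ (1 + (N : ℝ) / 2) = Real.pi * Real.sqrt Real.pi ^ N := by
    rw [Real.rpow_add Real.pi_pos, Real.rpow_one, Real.sqrt_eq_rpow,
      ← Real.rpow_natCast (Real.pi ^ (1 / 2 : ℝ)), ← Real.rpow_mul Real.pi_pos.le]
    congr 2
    ring
  have e3 : (2 : ℝ) ^ ((2 : ℝ) - α) = 4 * (2 ^ α)⁻¹ := by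
    rw [Real.rpow_sub (by norm_num), div_eq_mul_inv]
    norm_num
  have p1 : 0 < (2 : ℝ) ^ α := by positivity
  have p2 : 0 < Real.sqrt Real.pi ^ N := by positivity
  have := Real.pi_pos
  unfold beta'
  rw [e1, e2, e3, Real.Gamma_add_one (by positivity),
    show α * Real.pi / 2 = Real.pi * (α / 2) by ring]
  clear e1 e2 e3
  generalize Real.Gamma (α / 2) = g1 at *
  generalize Real.Gamma (1 - α / 2) = g2 at *
  generalize Real.sin (Real.pi * (α / 2)) = g3 at *
  field_simp
  linear_combination (4 * x ^ α) * hr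

lemma latNorm_sq (N : ℕ) (k : Fin N → ℤ) : latNorm N k ^ 2 = ∑ i, (k i : ℝ) ^ 2 :=
  Real.sq_sqrt (Finset.sum_nonneg fun _ _ => sq_nonneg _)

lemma latNorm_pos {N : ℕ} {k : Fin N → ℤ} (hk : k ≠ 0) : 0 < latNorm N k :=
  Real.sqrt_pos.mpr (lt_of_lt_of_le one_pos (one_le_sq_of_ne hk))

lemma term_eq (N : ℕ) (hN : 1 ≤ N) {A α h : ℝ} (hA : 0 ≤ A) (hα : α ∈ Set.Ioo (0 : ℝ) 2)
    (hh : 0 < h) (k : Fin N → ℤ) {ck : ℝ} (hc : 0 ≤ ck) (hc0 : k = 0 → ck = 0) :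
    ENNReal.ofReal (latNorm N k ^ (-α) * A * bConst N α * h ^ (-α) * (ck / latNorm N k ^ (N : ℝ)))
      = ENNReal.ofReal (A * beta' N α) * ∫⁻ u in Set.Ioi (0 : ℝ),
        ENNReal.ofReal (u ^ (((N : ℝ) + α) / 2 - 1) *
          (h ^ N * (Real.exp (-(u * h ^ 2) * ∑ i, (k i : ℝ) ^ 2) * ck))) := by
  by_cases hk : k = 0
  · simp [hc0 hk]
  have hl := latNorm_pos hk
  have hN' : (1 : ℝ) ≤ N := by exact_mod_cast hN
  have hα0 := hα.1
  have hp : 0 < ((N : ℝ) + α) / 2 := by positivity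
  have hβ := beta'_nonneg N hα.1.le hα.2.le
  have hG : 0 < Real.Gamma (((N : ℝ) + α) / 2) := Real.Gamma_pos_of_pos hp
  have hr : 0 < (h * latNorm N k) ^ 2 := by positivity
  have e1 : ∫⁻ u in Set.Ioi (0 : ℝ),
        ENNReal.ofReal (u ^ (((N : ℝ) + α) / 2 - 1) *
          (h ^ N * (Real.exp (-(u * h ^ 2) * ∑ i, (k i : ℝ) ^ 2) * ck)))
      = ENNReal.ofReal ((1 / (h * latNorm N k) ^ 2) ^ (((N : ℝ) + α) / 2) *
          Real.Gamma (((N : ℝ) + α) / 2)) * ENNReal.ofReal (h ^ N * ck) := by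
    rw [← lint_gamma hp hr, ← lintegral_mul_const _ (by fun_prop)]
    refine setLIntegral_congr_fun measurableSet_Ioi fun u hu => ?_
    have hu' : 0 ≤ u ^ (((N : ℝ) + α) / 2 - 1) := Real.rpow_nonneg (le_of_lt hu) _
    rw [← ENNReal.ofReal_mul (by positivity), ← latNorm_sq,
      show -(u * h ^ 2) * latNorm N k ^ 2 = -((h * latNorm N k) ^ 2 * u) by ring]
    congr 1
    ring
  rw [e1, ← ENNReal.ofReal_mul (by positivity), ← ENNReal.ofReal_mul (by positivity),
    bConst_eq N hα.1.le]
  congr 1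
  have e2 : (1 / (h * latNorm N k) ^ 2) ^ (((N : ℝ) + α) / 2)
      = (h ^ N)⁻¹ * h ^ (-α) * ((latNorm N k ^ (N : ℝ))⁻¹ * latNorm N k ^ (-α)) := by
    have e3 : (1 / (h * latNorm N k) ^ 2) = (h * latNorm N k) ^ (-2 : ℝ) := by
      rw [Real.rpow_neg (by positivity), one_div, show (2 : ℝ) = ((2 : ℕ) : ℝ) by norm_num,
        Real.rpow_natCast]
    rw [e3, ← Real.rpow_mul (by positivity), Real.mul_rpow hh.le hl.le,
      show (-2 : ℝ) * (((N : ℝ) + α) / 2) = -(N : ℝ) + -α by ring, Real.rpow_add hh,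
      Real.rpow_add hl, Real.rpow_neg hh.le, Real.rpow_neg hl.le, Real.rpow_natCast]
  rw [e2]
  field_simp

lemma ofReal_PhiC (N : ℕ) {h u : ℝ} (hh : 0 < h) (hu : 0 < u) (c : (Fin N → ℤ) → ℝ)
    (hc : ∀ k, 0 ≤ c k) (hc2 : ∀ k, c k ≤ 2) (y : ℝ) (hy : 0 ≤ y) :
    ENNReal.ofReal (y * PhiC N c h u) = ∑' k : Fin N → ℤ, ENNReal.ofReal (y *
          (h ^ N * (Real.exp (-(u * h ^ 2) * ∑ i, (k i : ℝ) ^ 2) * c k))) := by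
  have hs := summable_gaussN_mul N (s := u * h ^ 2) (by positivity) c
    (fun k => by rw [abs_of_nonneg (hc k)]; exact hc2 k)
  rw [PhiC, ← tsum_mul_left, ← tsum_mul_left, ENNReal.ofReal_tsum_of_nonneg]
  · intro k
    have := hc k
    positivity
  · exact (hs.mul_left _).mul_left _

lemma PhiC_aemeas (N : ℕ) {h : ℝ} (hh : 0 < h) (c : (Fin N → ℤ) → ℝ)
    (hc : ∀ k, 0 ≤ c k) (hc2 : ∀ k, c k ≤ 2) (p : ℝ) :
    AEMeasurable (fun u => ENNReal.ofReal (u ^ p * PhiC N c h u))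
      (volume.restrict (Set.Ioi (0 : ℝ))) := by
  have : AEMeasurable (fun u : ℝ => ∑' k : Fin N → ℤ, ENNReal.ofReal (u ^ p *
      (h ^ N * (Real.exp (-(u * h ^ 2) * ∑ i, (k i : ℝ) ^ 2) * c k))))
      (volume.restrict (Set.Ioi (0 : ℝ))) :=
    AEMeasurable.ennreal_tsum fun k => by fun_prop
  refine this.congr ?_
  filter_upwards [self_mem_ae_restrict measurableSet_Ioi] with u hu
  exact (ofReal_PhiC N hh hu c hc hc2 _ (Real.rpow_nonneg (le_of_lt hu) _)).symm

lemma sum_terms (N : ℕ) (hN : 1 ≤ N) {A α h : ℝ} (hA : 0 ≤ A) (hα : α ∈ Set.Ioo (0 : ℝ) 2)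
    (hh : 0 < h) (c : (Fin N → ℤ) → ℝ)
    (hc : ∀ k, 0 ≤ c k) (hc2 : ∀ k, c k ≤ 2) (hc0 : c 0 = 0) :
    ∑' k : Fin N → ℤ, ENNReal.ofReal (latNorm N k ^ (-α) * A * bConst N α * h ^ (-α) *
        (c k / latNorm N k ^ (N : ℝ)))
      = ENNReal.ofReal (A * beta' N α) * ∫⁻ u in Set.Ioi (0 : ℝ),
        ENNReal.ofReal (u ^ (((N : ℝ) + α) / 2 - 1) * PhiC N c h u) := by
  have e : ∀ k, _ := fun k => term_eq N hN hA hα hh k (hc k) (fun hk => by rw [hk, hc0])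
  rw [tsum_congr e, ENNReal.tsum_mul_left, ← lintegral_tsum (fun k => by fun_prop)]
  congr 1
  refine setLIntegral_congr_fun measurableSet_Ioi fun u hu => ?_
  exact (ofReal_PhiC N hh hu c hc hc2 _ (Real.rpow_nonneg (le_of_lt hu) _)).symm

lemma Q_integrable (N : ℕ) (hN : 1 ≤ N) {a : ℝ → ℝ} (ha_int : Integrable a) {h : ℝ}
    (hh : 0 < h) (k : Fin N → ℤ) (hk : k ≠ 0) :
    IntegrableOn (fun α => latNorm N k ^ (-α) * a α * bConst N α * h ^ (-α)) (Set.Icc 0 2) := by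
  have hl := latNorm_pos hk
  have hg : ContinuousOn (fun α => latNorm N k ^ (-α) * (bConst N α * h ^ (-α))) (Set.Icc 0 2) := by
    refine ContinuousOn.mul ?_ ((bConst_cont N hN).mul ?_)
    · exact ContinuousOn.rpow continuousOn_const (by fun_prop) fun _ _ => Or.inl hl.ne'
    · exact ContinuousOn.rpow continuousOn_const (by fun_prop) fun _ _ => Or.inl hh.ne'
  refine (ha_int.integrableOn.mul_continuousOn hg isCompact_Icc).congr_fun (fun α _ => ?_)
    measurableSet_Icc
  ring

lemma Q_term (N : ℕ) (hN : 1 ≤ N) {a : ℝ → ℝ} (ha_nonneg : ∀ s, 0 ≤ a s)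
    (ha_int : Integrable a) {h : ℝ}
    (hh : 0 < h) (k : Fin N → ℤ) {ck : ℝ} (hc : 0 ≤ ck) (hc0 : k = 0 → ck = 0) :
    ENNReal.ofReal (Qcoef N a h k / latNorm N k ^ (N : ℝ) * ck) =
      ∫⁻ α in Set.Ioo (0 : ℝ) 2, ENNReal.ofReal (latNorm N k ^ (-α) * a α * bConst N α * h ^ (-α) *
        (ck / latNorm N k ^ (N : ℝ))) := by
  by_cases hk : k = 0
  · simp [hc0 hk]
  have hl := latNorm_pos hk
  have hi := (Q_integrable N hN ha_int hh k hk).mono_set Set.Ioo_subset_Icc_self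
  rw [← ofReal_integral_eq_lintegral_ofReal (hi.mul_const _), integral_mul_const, Qcoef,
    intervalIntegral.integral_of_le (by norm_num), integral_Ioc_eq_integral_Ioo]
  · congr 1
    ring
  · filter_upwards [self_mem_ae_restrict measurableSet_Ioo] with α hα
    have := ha_nonneg α
    have := bConst_nonneg N hN hα.1.le hα.2.le
    positivity

lemma main_sum (N : ℕ) (hN : 1 ≤ N) {a : ℝ → ℝ} (ha_meas : Measurable a)
    (ha_nonneg : ∀ s, 0 ≤ a s) (ha_int : Integrable a) {h : ℝ} (hh : 0 < h)
    (c : (Fin N → ℤ) → ℝ)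
    (hc : ∀ k, 0 ≤ c k) (hc2 : ∀ k, c k ≤ 2) (hc0 : c 0 = 0) :
    AEMeasurable (fun α => ENNReal.ofReal (a α * beta' N α) *
      ∫⁻ u in Set.Ioi (0 : ℝ),
        ENNReal.ofReal (u ^ (((N : ℝ) + α) / 2 - 1) * PhiC N c h u))
        (volume.restrict (Set.Ioo (0 : ℝ) 2)) ∧
    ∑' k : Fin N → ℤ, ENNReal.ofReal (Qcoef N a h k / latNorm N k ^ (N : ℝ) * c k) =
      ∫⁻ α in Set.Ioo (0 : ℝ) 2, ENNReal.ofReal (a α * beta' N α) *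
      ∫⁻ u in Set.Ioi (0 : ℝ),
        ENNReal.ofReal (u ^ (((N : ℝ) + α) / 2 - 1) * PhiC N c h u) := by
  have hb : AEMeasurable (bConst N) (volume.restrict (Set.Ioo (0 : ℝ) 2)) :=
    ((bConst_cont N hN).mono Set.Ioo_subset_Icc_self).aemeasurable measurableSet_Ioo
  have hm : ∀ k : Fin N → ℤ, AEMeasurable (fun α => ENNReal.ofReal (latNorm N k ^ (-α) * a α *
      bConst N α * h ^ (-α) * (c k / latNorm N k ^ (N : ℝ))))
      (volume.restrict (Set.Ioo (0 : ℝ) 2)) := fun k => by fun_prop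
  constructor
  · refine (AEMeasurable.ennreal_tsum hm).congr ?_
    filter_upwards [self_mem_ae_restrict measurableSet_Ioo] with α hα
    exact sum_terms N hN (ha_nonneg α) hα hh c hc hc2 hc0
  · rw [tsum_congr fun k => Q_term N hN ha_nonneg ha_int hh k (hc k) (fun hk => by rw [hk, hc0]),
      ← lintegral_tsum hm]
    refine setLIntegral_congr_fun measurableSet_Ioo fun α hα => ?_
    exact sum_terms N hN (ha_nonneg α) hα hh c hc hc2 hc0

lemma rpow_split (N : ℕ) {u α : ℝ} (hu : 0 < u) :
    u ^ (((N : ℝ) + α) / 2 - 1) * u ^ (-((N : ℝ) / 2)) = u ^ (α / 2 - 1) := by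
  rw [← Real.rpow_add hu]; congr 1; ring

/-- inner integral bound -/
lemma J_bound (N : ℕ) {α h C : ℝ} (hα : α ∈ Set.Ioo (0 : ℝ) 2) (hC : 0 ≤ C)
    (c : (Fin N → ℤ) → ℝ)
    (hb : ∀ u, 0 < u → PhiC N c h u ≤ C * (u ^ (-((N : ℝ) / 2)) * min 1 u⁻¹)) :
    ∫⁻ u in Set.Ioi (0 : ℝ), ENNReal.ofReal (u ^ (((N : ℝ) + α) / 2 - 1) * PhiC N c h u)
      ≤ ENNReal.ofReal (C * (2 / α + 2 / (2 - α))) := by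
  rw [ENNReal.ofReal_mul hC]
  refine le_trans ?_ (mul_le_mul_right (lint_min hα.1 hα.2) _)
  rw [← lintegral_const_mul _ (by fun_prop)]
  refine setLIntegral_mono' measurableSet_Ioi fun u hu => ?_
  rw [← ENNReal.ofReal_mul hC]
  apply ENNReal.ofReal_le_ofReal
  have h1 := mul_le_mul_of_nonneg_left (hb u hu)
    (Real.rpow_nonneg (le_of_lt hu) (((N : ℝ) + α) / 2 - 1))
  refine h1.trans_eq ?_
  rw [← rpow_split N (α := α) hu]
  ring

lemma F_bound (N : ℕ) {a : ℝ → ℝ} (ha_nonneg : ∀ s, 0 ≤ a s) {α h C M : ℝ}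
    (hα : α ∈ Set.Ioo (0 : ℝ) 2) (hC : 0 ≤ C)
    (hM : beta' N α * (2 / α + 2 / (2 - α)) ≤ M)
    (c : (Fin N → ℤ) → ℝ)
    (hb : ∀ u, 0 < u → PhiC N c h u ≤ C * (u ^ (-((N : ℝ) / 2)) * min 1 u⁻¹)) :
    ENNReal.ofReal (a α * beta' N α) *
      ∫⁻ u in Set.Ioi (0 : ℝ), ENNReal.ofReal (u ^ (((N : ℝ) + α) / 2 - 1) * PhiC N c h u)
      ≤ ENNReal.ofReal (a α * (C * M)) := by
  refine (mul_le_mul_right (J_bound N hα hC c hb) _).trans ?_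
  have ha := ha_nonneg α
  have hβ := beta'_nonneg N hα.1.le hα.2.le
  rw [← ENNReal.ofReal_mul (by positivity)]
  apply ENNReal.ofReal_le_ofReal
  calc _ = a α * (C * (beta' N α * (2 / α + 2 / (2 - α)))) := by ring
    _ ≤ _ := by gcongr

lemma a_lint_ne_top {a : ℝ → ℝ} (ha_int : Integrable a) (K : ℝ) :
    ∫⁻ α in Set.Ioo (0 : ℝ) 2, ENNReal.ofReal (a α * K) ≠ ⊤ := by
  have := (ha_int.mul_const K).lintegral_lt_top
  exact ((setLIntegral_le_lintegral _ _).trans_lt this).ne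

lemma w_nonneg (N : ℕ) (hN : 1 ≤ N) {a : ℝ → ℝ} (ha_nonneg : ∀ s, 0 ≤ a s) {h : ℝ} (hh : 0 < h)
    (k : Fin N → ℤ) : 0 ≤ Qcoef N a h k / latNorm N k ^ (N : ℝ) := by
  have hl : 0 ≤ latNorm N k := Real.sqrt_nonneg _
  refine div_nonneg ?_ (Real.rpow_nonneg hl _)
  refine intervalIntegral.integral_nonneg (by norm_num) fun α hα => ?_
  have := ha_nonneg α
  have := bConst_nonneg N hN hα.1 hα.2
  have := Real.rpow_nonneg hl (-α)
  positivity

lemma w_summable (N : ℕ) (hN : 1 ≤ N) {a : ℝ → ℝ} (ha_meas : Measurable a)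
    (ha_nonneg : ∀ s, 0 ≤ a s) (ha_int : Integrable a) {h : ℝ} (hh : 0 < h) :
    Summable fun k : Fin N → ℤ => Qcoef N a h k / latNorm N k ^ (N : ℝ) * ow N k := by
  obtain ⟨C, hC, hb⟩ := Phi_ow_bound N hh
  obtain ⟨M, hM, hbM⟩ := beta'_bound N
  have h1 : ∀ k, 0 ≤ ow N k := fun k => by unfold ow; split_ifs <;> norm_num
  have h2 : ∀ k, ow N k ≤ 2 := fun k => by unfold ow; split_ifs <;> norm_num
  have h3 : ow N 0 = 0 := by simp [ow]
  have hs := (main_sum N hN ha_meas ha_nonneg ha_int hh (ow N) h1 h2 h3).2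
  have hfin : ∑' k : Fin N → ℤ, ENNReal.ofReal (Qcoef N a h k / latNorm N k ^ (N : ℝ) * ow N k) ≠ ⊤ := by
    rw [hs]
    refine ne_top_of_le_ne_top (a_lint_ne_top ha_int (C * M)) ?_
    refine setLIntegral_mono' measurableSet_Ioo fun α hα => ?_
    exact F_bound N ha_nonneg hα hC (hbM α hα) _ hb
  refine (ENNReal.summable_toReal hfin).congr fun k => ?_
  exact ENNReal.toReal_ofReal (mul_nonneg (w_nonneg N hN ha_nonneg hh k) (h1 k))

lemma E_tendsto (N : ℕ) (hN : 1 ≤ N) {a : ℝ → ℝ} (ha_meas : Measurable a)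
    (ha_nonneg : ∀ s, 0 ≤ a s) (ha_int : Integrable a) (ξ : EuclideanSpace ℝ (Fin N)) :
    Tendsto (fun h : ℝ => ∑' k : Fin N → ℤ,
        Qcoef N a h k / latNorm N k ^ (N : ℝ) * cw N ξ h k) (𝓝[>] 0)
      (𝓝 (∫ α in (0 : ℝ)..2, a α * ‖ξ‖ ^ α / 2)) := by
  obtain ⟨C, hC, hb⟩ := Phi_bound N ξ
  obtain ⟨M, hM, hbM⟩ := beta'_bound N
  have hJ : ∀ α ∈ Set.Ioo (0 : ℝ) 2, Tendsto (fun h : ℝ => ∫⁻ u in Set.Ioi (0 : ℝ),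
      ENNReal.ofReal (u ^ (((N : ℝ) + α) / 2 - 1) * PhiC N (cw N ξ h) h u)) (𝓝[>] 0)
      (𝓝 (∫⁻ u in Set.Ioi (0 : ℝ), ENNReal.ofReal (u ^ (((N : ℝ) + α) / 2 - 1) *
        (Real.sqrt (Real.pi / u) ^ N * (1 - Real.exp (-(‖ξ‖ ^ 2 / (4 * u)))))))) := by
    intro α hα
    refine tendsto_lintegral_filter_of_dominated_convergence'
      (fun u => ENNReal.ofReal C * ENNReal.ofReal (u ^ (α / 2 - 1) * min 1 u⁻¹)) ?_ ?_ ?_ ?_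
    · filter_upwards [self_mem_nhdsWithin] with h hh
      exact PhiC_aemeas N hh _ (cw_nonneg N ξ h) (cw_le N ξ h) _
    · filter_upwards [self_mem_nhdsWithin] with h hh
      filter_upwards [self_mem_ae_restrict measurableSet_Ioi] with u hu
      rw [← ENNReal.ofReal_mul hC]
      apply ENNReal.ofReal_le_ofReal
      have h1 := mul_le_mul_of_nonneg_left (hb h u hh hu)
        (Real.rpow_nonneg (le_of_lt hu) (((N : ℝ) + α) / 2 - 1))
      refine h1.trans_eq ?_
      rw [← rpow_split N (α := α) hu]
      ring
    · rw [lintegral_const_mul _ (by fun_prop)]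
      exact ENNReal.mul_ne_top ENNReal.ofReal_ne_top
        (ne_top_of_le_ne_top ENNReal.ofReal_ne_top (lint_min hα.1 hα.2))
    · filter_upwards [self_mem_ae_restrict measurableSet_Ioi] with u hu
      exact ENNReal.tendsto_ofReal ((Phi_tendsto N hu ξ).const_mul _)
  have hlim : ∀ α ∈ Set.Ioo (0 : ℝ) 2, ENNReal.ofReal (a α * beta' N α) *
      (∫⁻ u in Set.Ioi (0 : ℝ), ENNReal.ofReal (u ^ (((N : ℝ) + α) / 2 - 1) *
        (Real.sqrt (Real.pi / u) ^ N * (1 - Real.exp (-(‖ξ‖ ^ 2 / (4 * u)))))))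
      = ENNReal.ofReal (a α * ‖ξ‖ ^ α / 2) := by
    intro α hα
    have ha := ha_nonneg α
    have hβ := beta'_nonneg N hα.1.le hα.2.le
    have e1 : ∫⁻ u in Set.Ioi (0 : ℝ), ENNReal.ofReal (u ^ (((N : ℝ) + α) / 2 - 1) *
        (Real.sqrt (Real.pi / u) ^ N * (1 - Real.exp (-(‖ξ‖ ^ 2 / (4 * u))))))
        = ENNReal.ofReal (Real.sqrt Real.pi ^ N *
          (Real.Gamma (1 - α / 2) * ((‖ξ‖ ^ 2 / 4) ^ (α / 2) / (α / 2)))) := by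
      rw [ENNReal.ofReal_mul (by positivity), ← lint_limit hα.1 hα.2 (by positivity),
        ← lintegral_const_mul _ (by fun_prop)]
      refine setLIntegral_congr_fun measurableSet_Ioi fun u hu => ?_
      have hu : 0 < u := hu
      rw [← ENNReal.ofReal_mul (by positivity)]
      congr 1
      rw [← rpow_split N (α := α) hu, Real.sqrt_div Real.pi_pos.le, div_pow, div_div, Real.rpow_neg hu.le,
        Real.sqrt_eq_rpow u, ← Real.rpow_natCast (u ^ (1 / 2 : ℝ)), ← Real.rpow_mul hu.le,
        show (1 / 2 : ℝ) * N = N / 2 by ring]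
      ring
    rw [e1, ← ENNReal.ofReal_mul (by positivity), mul_assoc,
      const_eq N hα.1 hα.2 (norm_nonneg ξ), mul_div_assoc]
  have hF : Tendsto (fun h : ℝ => ∫⁻ α in Set.Ioo (0 : ℝ) 2, ENNReal.ofReal (a α * beta' N α) *
      ∫⁻ u in Set.Ioi (0 : ℝ),
        ENNReal.ofReal (u ^ (((N : ℝ) + α) / 2 - 1) * PhiC N (cw N ξ h) h u)) (𝓝[>] 0)
      (𝓝 (∫⁻ α in Set.Ioo (0 : ℝ) 2, ENNReal.ofReal (a α * ‖ξ‖ ^ α / 2))) := by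
    refine tendsto_lintegral_filter_of_dominated_convergence'
      (fun α => ENNReal.ofReal (a α * (C * M))) ?_ ?_ (a_lint_ne_top ha_int _) ?_
    · filter_upwards [self_mem_nhdsWithin] with h hh
      exact (main_sum N hN ha_meas ha_nonneg ha_int hh _ (cw_nonneg N ξ h) (cw_le N ξ h)
        (cw_zero N ξ h)).1
    · filter_upwards [self_mem_nhdsWithin] with h hh
      filter_upwards [self_mem_ae_restrict measurableSet_Ioo] with α hα
      exact F_bound N ha_nonneg hα hC (hbM α hα) _ (fun u hu => hb h u hh hu)
    · filter_upwards [self_mem_ae_restrict measurableSet_Ioo] with α hα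
      rw [← hlim α hα]
      exact ENNReal.Tendsto.const_mul (hJ α hα) (Or.inr ENNReal.ofReal_ne_top)
  have hint : IntegrableOn (fun α => a α * ‖ξ‖ ^ α / 2) (Set.Ioo 0 2) := by
    have h1 : IntegrableOn (fun α => a α * (1 + ‖ξ‖ ^ 2)) (Set.Ioo 0 2) :=
      (ha_int.mul_const _).integrableOn
    refine h1.mono' (by fun_prop) ?_
    filter_upwards [self_mem_ae_restrict measurableSet_Ioo] with α hα
    have ha := ha_nonneg α
    have hx : ‖ξ‖ ^ α ≤ 1 + ‖ξ‖ ^ 2 := by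
      rcases le_total ‖ξ‖ 1 with hx | hx
      · have := Real.rpow_le_one (norm_nonneg ξ) hx hα.1.le
        have := sq_nonneg ‖ξ‖
        linarith
      · have := Real.rpow_le_rpow_of_exponent_le hx hα.2.le
        rw [show (2 : ℝ) = ((2 : ℕ) : ℝ) by norm_num, Real.rpow_natCast] at this
        linarith
    have hx0 : 0 ≤ ‖ξ‖ ^ α := Real.rpow_nonneg (norm_nonneg ξ) _
    rw [Real.norm_eq_abs, abs_of_nonneg (by positivity)]
    have := mul_le_mul_of_nonneg_left hx ha
    have := mul_nonneg ha hx0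
    linarith
  have e2 : ∫⁻ α in Set.Ioo (0 : ℝ) 2, ENNReal.ofReal (a α * ‖ξ‖ ^ α / 2)
      = ENNReal.ofReal (∫ α in (0 : ℝ)..2, a α * ‖ξ‖ ^ α / 2) := by
    rw [intervalIntegral.integral_of_le (by norm_num), integral_Ioc_eq_integral_Ioo,
      ofReal_integral_eq_lintegral_ofReal hint]
    filter_upwards with α
    have ha := ha_nonneg α
    positivity
  have h0 : 0 ≤ ∫ α in (0 : ℝ)..2, a α * ‖ξ‖ ^ α / 2 :=
    intervalIntegral.integral_nonneg (by norm_num) fun α _ => by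
      have ha := ha_nonneg α
      positivity
  rw [e2] at hF
  have := (ENNReal.tendsto_toReal ENNReal.ofReal_ne_top).comp hF
  rw [ENNReal.toReal_ofReal h0] at this
  refine this.congr' ?_
  filter_upwards [self_mem_nhdsWithin] with h hh
  have hms := (main_sum N hN ha_meas ha_nonneg ha_int hh _ (cw_nonneg N ξ h) (cw_le N ξ h)
        (cw_zero N ξ h)).2
  simp only [Function.comp]
  rw [← hms, ENNReal.tsum_toReal_eq (fun _ => ENNReal.ofReal_ne_top)]
  refine tsum_congr fun k => ?_
  exact ENNReal.toReal_ofReal (mul_nonneg (w_nonneg N hN ha_nonneg hh k) (cw_nonneg N ξ h k))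

lemma latNorm_neg' (N : ℕ) (k : Fin N → ℤ) : latNorm N (-k) = latNorm N k := by
  simp [latNorm]

lemma latDot_neg' (N : ℕ) (k : Fin N → ℤ) (ξ : EuclideanSpace ℝ (Fin N)) :
    latDot N (-k) ξ = - latDot N k ξ := by
  simp [latDot, Finset.sum_neg_distrib]

lemma char_eq (N : ℕ) (a : ℝ → ℝ) (h τ : ℝ) (ξ : EuclideanSpace ℝ (Fin N))
    (hs : Summable fun k : Fin N → ℤ => Qcoef N a h k / latNorm N k ^ (N:ℝ) * ow N k) :
    ∑' k : Fin N → ℤ, ((transProb N a τ h k : ℝ) : ℂ) *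
        Complex.exp (Complex.I * ((h * latDot N k ξ : ℝ) : ℂ)) =
      ((1 - 2 * τ * ∑' k : Fin N → ℤ,
        Qcoef N a h k / latNorm N k ^ (N:ℝ) * cw N ξ h k : ℝ) : ℂ) := by
  set W : (Fin N → ℤ) → ℝ := fun k => Qcoef N a h k / latNorm N k ^ (N:ℝ) * ow N k with hW
  have hsig : sigmaConst N a τ h = 2 * τ * ∑' k, W k := by
    unfold sigmaConst
    congr 1
    have h1 := tsum_subtype {k : Fin N → ℤ | k ≠ 0}
      (fun k => Qcoef N a h k / latNorm N k ^ (N:ℝ))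
    refine h1.trans (tsum_congr fun k => ?_)
    by_cases hk : k = 0 <;> simp [hW, ow, hk]
  have hWneg : ∀ k, W (-k) = W k := by
    intro k
    simp [hW, ow, Qcoef, latNorm_neg']
  have hsn : Summable fun k => |W k| := hs.abs
  have hc : Summable fun k => W k * Real.cos (h * latDot N k ξ) := by
    refine Summable.of_norm_bounded hsn fun k => ?_
    rw [Real.norm_eq_abs, abs_mul]
    exact mul_le_of_le_one_right (abs_nonneg _) (Real.abs_cos_le_one _)
  have hsi : Summable fun k => W k * Real.sin (h * latDot N k ξ) := by
    refine Summable.of_norm_bounded hsn fun k => ?_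
    rw [Real.norm_eq_abs, abs_mul]
    exact mul_le_of_le_one_right (abs_nonneg _) (Real.abs_sin_le_one _)
  have hsin0 : ∑' k, W k * Real.sin (h * latDot N k ξ) = 0 := by
    have e := (Equiv.neg (Fin N → ℤ)).tsum_eq (fun k => W k * Real.sin (h * latDot N k ξ))
    simp only [Equiv.neg_apply, hWneg, latDot_neg', mul_neg, Real.sin_neg, tsum_neg] at e
    linarith
  have hcw : ∑' k, Qcoef N a h k / latNorm N k ^ (N:ℝ) * cw N ξ h k
      = ∑' k, W k - ∑' k, W k * Real.cos (h * latDot N k ξ) := by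
    rw [← hs.tsum_sub hc]
    refine tsum_congr fun k => ?_
    by_cases hk : k = 0
    · subst hk
      simp [hW, ow, cw_zero]
    · simp only [hW, ow, hk, if_false, cw]
      ring
  have hterm : ∀ k, ((transProb N a τ h k : ℝ) : ℂ) *
        Complex.exp (Complex.I * ((h * latDot N k ξ : ℝ) : ℂ)) =
      (((if k = 0 then 1 - sigmaConst N a τ h else 0) : ℝ) : ℂ) +
      ((2 * τ * (W k * Real.cos (h * latDot N k ξ)) : ℝ) : ℂ) +
      ((2 * τ * (W k * Real.sin (h * latDot N k ξ)) : ℝ) : ℂ) * Complex.I := by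
    intro k
    by_cases hk : k = 0
    · subst hk
      simp [transProb, hW, ow, latDot]
    · rw [mul_comm Complex.I, Complex.exp_mul_I, ← Complex.ofReal_cos, ← Complex.ofReal_sin]
      simp only [transProb, hW, ow, hk, if_false]
      push_cast
      ring
  have H1 : HasSum (fun k : Fin N → ℤ => (((if k = 0 then 1 - sigmaConst N a τ h else 0) : ℝ) : ℂ))
      ((1 - sigmaConst N a τ h : ℝ) : ℂ) :=
    Complex.hasSum_ofReal.2 (hasSum_ite_eq 0 _)
  have H2 : HasSum (fun k => ((2 * τ * (W k * Real.cos (h * latDot N k ξ)) : ℝ) : ℂ))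
      ((2 * τ * ∑' k, W k * Real.cos (h * latDot N k ξ) : ℝ) : ℂ) :=
    Complex.hasSum_ofReal.2 (hc.hasSum.mul_left _)
  have H3 : HasSum (fun k => ((2 * τ * (W k * Real.sin (h * latDot N k ξ)) : ℝ) : ℂ) * Complex.I)
      (((2 * τ * ∑' k, W k * Real.sin (h * latDot N k ξ) : ℝ) : ℂ) * Complex.I) :=
    (Complex.hasSum_ofReal.2 (hsi.hasSum.mul_left _)).mul_right _
  rw [tsum_congr hterm, ((H1.add H2).add H3).tsum_eq, hsin0, hcw, hsig]
  push_cast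
  ring

/-- **Theorem 3.1 (characteristic-function form).** Under the scaling `τ_n = t/n`, `h_n → 0⁺`
and the normalization condition `2τ_n ∫₀² a(α) b(α) R(α) h_n^{-α} dα ≤ 1`, the characteristic
function of the `n`-step random walk converges to `exp(-t ∫₀² a(α)|ξ|^α dα)`, the Fourier
transform of the fundamental solution of the distributed order diffusion equation. -/
theorem stmt_11 (N : ℕ) (hN : 1 ≤ N) (a : ℝ → ℝ)
    (ha_meas : Measurable a) (ha_nonneg : ∀ s, 0 ≤ a s)
    (ha_supp : ∀ s, s ∉ Set.Ioo (0 : ℝ) 2 → a s = 0) (ha_int : Integrable a)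
    (t : ℝ) (ht : 0 < t) (h : ℕ → ℝ) (hh_pos : ∀ n, 0 < h n)
    (hh0 : Tendsto h atTop (𝓝 0))
    (hcond : ∀ n : ℕ, ENNReal.ofReal (2 * (t / n)) *
        ∫⁻ α in Set.Ioo (0 : ℝ) 2,
          ENNReal.ofReal (a α * bConst N α * Rlat N α * h n ^ (-α)) ≤ 1)
    (ξ : EuclideanSpace ℝ (Fin N)) :
    Tendsto (fun n : ℕ =>
        (∑' k : Fin N → ℤ,
            ((transProb N a (t / n) (h n) k : ℝ) : ℂ) *
              Complex.exp (Complex.I * ((h n * latDot N k ξ : ℝ) : ℂ))) ^ n)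
      atTop
      (𝓝 (Complex.exp (-(((t * ∫ α in (0 : ℝ)..2, a α * ‖ξ‖ ^ α : ℝ)) : ℂ)))) := by
  have hE := E_tendsto N hN ha_meas ha_nonneg ha_int ξ
  have hh : Tendsto h atTop (𝓝[>] 0) :=
    tendsto_nhdsWithin_iff.2 ⟨hh0, Eventually.of_forall hh_pos⟩
  have hE2 := hE.comp hh
  set E : ℝ → ℝ := fun x => ∑' k : Fin N → ℤ,
    Qcoef N a x k / latNorm N k ^ (N:ℝ) * cw N ξ x k with hEdef
  have hlim : Tendsto (fun n : ℕ => (n : ℝ) * (-(2 * (t / n) * E (h n)))) atTop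
      (𝓝 (-(t * ∫ α in (0 : ℝ)..2, a α * ‖ξ‖ ^ α))) := by
    have h1 : Tendsto (fun n : ℕ => -(2 * t) * E (h n)) atTop
        (𝓝 (-(2 * t) * ∫ α in (0 : ℝ)..2, a α * ‖ξ‖ ^ α / 2)) := hE2.const_mul _
    have e : -(t * ∫ α in (0 : ℝ)..2, a α * ‖ξ‖ ^ α)
        = -(2 * t) * ∫ α in (0 : ℝ)..2, a α * ‖ξ‖ ^ α / 2 := by
      rw [intervalIntegral.integral_div]
      ring
    rw [e]
    refine h1.congr' ?_
    filter_upwards [eventually_gt_atTop 0] with n hn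
    have : (n : ℝ) ≠ 0 := by positivity
    field_simp
  have hfin := Real.tendsto_one_add_pow_exp_of_tendsto hlim
  have hfin2 := (Complex.continuous_ofReal.tendsto _).comp hfin
  rw [Complex.ofReal_exp, Complex.ofReal_neg] at hfin2
  refine hfin2.congr fun n => ?_
  rw [char_eq N a (h n) (t / n) ξ (w_summable N hN ha_meas ha_nonneg ha_int (hh_pos n))]
  simp only [Function.comp, Complex.ofReal_pow, hEdef, sub_eq_add_neg]
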